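/- arXiv:1911.08102 — 2 statements merged into one kernel-verified Lean document; each statement's English description precedes it below -/
import Mathlib

section
/- Let G be a finite bipartite simple graph with a fixed proper 2-coloring of its vertices into black and white, with V_B black vertices and V_W white vertices in total. Then 2^{|V_W|} · |C_B(G)| = 2^{|V_B|} · |C_W(G)| (equivalently, dim C_B(G) − dim C_W(G) = |V_B| − |V_W| over ℤ/2ℤ). In particular, if |V_B| = |V_W| then |C_B(G)| = |C_W(G)| and the number of channels of G equals |C_B(G)|². -/
/-- A channel of `G` is a set `C` of vertices such that every vertex of `G`
has an even number of neighbors in `C`. -/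
def IsChannel {V : Type*} (G : SimpleGraph V) (C : Set V) : Prop :=
  ∀ v : V, Even {w | w ∈ C ∧ G.Adj v w}.ncard

open scoped Classical in
/-- The biadjacency matrix of `G` over `ZMod 2` between the color classes `a` and `b`. -/
noncomputable def biadjMatrix {V : Type*} (G : SimpleGraph V) (color : V → Bool) (a b : Bool) :
    Matrix {v : V // color v = a} {v : V // color v = b} (ZMod 2) :=
  Matrix.of fun v w => if G.Adj v w then 1 else 0

open scoped Classical in
lemma biadjMatrix_transpose {V : Type*} (G : SimpleGraph V) (color : V → Bool) (a b : Bool) :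
    (biadjMatrix G color a b).transpose = biadjMatrix G color b a := by
  ext v w
  exact if_congr (G.adj_comm _ _) rfl rfl

open scoped Classical in
lemma isChannel_iff_sum_eq_zero {V : Type*} [Fintype V] (G : SimpleGraph V) (C : Set V) :
    IsChannel G C ↔ ∀ v, ∑ w, (if w ∈ C ∧ G.Adj v w then (1 : ZMod 2) else 0) = 0 := by
  refine forall_congr' fun v => ?_
  rw [Finset.sum_boole, ZMod.natCast_eq_zero_iff_even, Set.ncard_eq_toFinset_card',
    Set.toFinset_ofPred]

open scoped Classical in
/-- A set in the color class `b` is a channel iff the biadjacency matrix kills its indicator. -/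
lemma isChannel_iff_biadjMatrix_mulVec {V : Type*} [Fintype V] (G : SimpleGraph V)
    (color : V → Bool) (hcol : ∀ ⦃v w : V⦄, G.Adj v w → color v ≠ color w) {a b : Bool}
    (hab : a ≠ b) (C : Set V) (hC : ∀ v ∈ C, color v = b) :
    IsChannel G C ↔
      (biadjMatrix G color a b).mulVec (fun w => if (w : V) ∈ C then 1 else 0) = 0 := by
  have key : ∀ v : V, ∑ w, (if w ∈ C ∧ G.Adj v w then (1 : ZMod 2) else 0) =
      ∑ w : {w : V // color w = b}, if (w : V) ∈ C ∧ G.Adj v w then (1 : ZMod 2) else 0 := by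
    intro v
    rw [← Finset.sum_subtype {w | color w = b} (by simp)
      (fun w => if w ∈ C ∧ G.Adj v w then (1 : ZMod 2) else 0)]
    refine (Finset.sum_subset (Finset.subset_univ _) fun w _ hw => if_neg fun h => hw ?_).symm
    simpa using hC w h.1
  rw [isChannel_iff_sum_eq_zero, funext_iff]
  have hmul : ∀ v : {v : V // color v = a},
      (biadjMatrix G color a b).mulVec (fun w => if (w : V) ∈ C then 1 else 0) v =
        ∑ w, (if w ∈ C ∧ G.Adj v w then (1 : ZMod 2) else 0) := by
    intro v
    rw [key]
    simp only [Matrix.mulVec, dotProduct, biadjMatrix, Matrix.of_apply]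
    refine Finset.sum_congr rfl fun w _ => ?_
    split_ifs <;> simp_all
  refine ⟨fun h v => (hmul v).trans (h v), fun h v => ?_⟩
  by_cases hv : color v = a
  · exact (hmul ⟨v, hv⟩).symm.trans (h ⟨v, hv⟩)
  · refine Finset.sum_eq_zero fun w _ => if_neg fun hw => hcol hw.2 ?_
    rw [hC w hw.1]
    cases a <;> cases b <;> simp_all

open scoped Classical in
/-- Channels inside the color class `b` correspond to the kernel of the biadjacency matrix. -/
noncomputable def channelEquivKer {V : Type*} [Fintype V] (G : SimpleGraph V)
    (color : V → Bool) (hcol : ∀ ⦃v w : V⦄, G.Adj v w → color v ≠ color w) {a b : Bool}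
    (hab : a ≠ b) :
    {C : Set V // IsChannel G C ∧ ∀ v ∈ C, color v = b} ≃
      LinearMap.ker (biadjMatrix G color a b).mulVecLin where
  toFun C := ⟨fun w => if (w : V) ∈ C.1 then 1 else 0,
    (isChannel_iff_biadjMatrix_mulVec G color hcol hab C.1 C.2.2).1 C.2.1⟩
  invFun f := ⟨{v | ∃ h : color v = b, f.1 ⟨v, h⟩ = 1}, by
    have hb : ∀ v ∈ {v | ∃ h : color v = b, f.1 ⟨v, h⟩ = 1}, color v = b := fun v hv => hv.1
    refine ⟨(isChannel_iff_biadjMatrix_mulVec G color hcol hab _ hb).2 ?_, hb⟩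
    convert LinearMap.mem_ker.1 f.2 using 2
    rw [Matrix.mulVecLin_apply]
    congr 1
    ext w
    have h01 : ∀ x : ZMod 2, (if x = 1 then 1 else 0) = x := by decide
    simpa [w.2] using h01 (f.1 w)⟩
  left_inv C := by
    ext v
    simpa using C.2.2 v
  right_inv f := by
    ext w
    have h01 : ∀ x : ZMod 2, (if x = 1 then 1 else 0) = x := by decide
    simpa [w.2] using h01 (f.1 w)

lemma card_channels_mul_two_pow_rank {V : Type*} [Fintype V] (G : SimpleGraph V)
    (color : V → Bool) (hcol : ∀ ⦃v w : V⦄, G.Adj v w → color v ≠ color w) {a b : Bool}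
    (hab : a ≠ b) :
    2 ^ (biadjMatrix G color a b).rank *
        Nat.card {C : Set V // IsChannel G C ∧ ∀ v ∈ C, color v = b} =
      2 ^ Fintype.card {v : V // color v = b} := by
  rw [Nat.card_congr (channelEquivKer G color hcol hab),
    Module.natCard_eq_pow_finrank (K := ZMod 2), Nat.card_zmod, ← pow_add, Matrix.rank,
    LinearMap.finrank_range_add_finrank_ker, Module.finrank_fintype_fun_eq_card]

lemma IsChannel.inter_color {V : Type*} {G : SimpleGraph V} {color : V → Bool}
    (hcol : ∀ ⦃v w : V⦄, G.Adj v w → color v ≠ color w) {C : Set V} (hC : IsChannel G C)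
    (b : Bool) : IsChannel G (C ∩ {v | color v = b}) := by
  intro v
  by_cases hv : color v = b
  · have h : {w | w ∈ C ∩ {v | color v = b} ∧ G.Adj v w} = ∅ :=
      Set.eq_empty_of_forall_notMem fun w hw => hcol hw.2 (hv.trans hw.1.2.symm)
    simp only [h, Set.ncard_empty, Even.zero]
  · convert hC v using 2
    ext w
    have hw : G.Adj v w → color w = b := fun h => by
      have := hcol h
      revert this hv
      cases color v <;> cases color w <;> cases b <;> simp
    simp only [Set.mem_inter_iff, Set.mem_ofPred_eq]
    tauto

lemma IsChannel.union {V : Type*} [Finite V] {G : SimpleGraph V} {C D : Set V}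
    (hC : IsChannel G C) (hD : IsChannel G D) (hCD : Disjoint C D) : IsChannel G (C ∪ D) := by
  intro v
  have h : {w | w ∈ C ∪ D ∧ G.Adj v w} =
      {w | w ∈ C ∧ G.Adj v w} ∪ {w | w ∈ D ∧ G.Adj v w} := by
    ext w
    simp [or_and_right]
  rw [h, Set.ncard_union_eq (hCD.mono (fun _ hw => hw.1) fun _ hw => hw.1)]
  exact (hC v).add (hD v)

/-- A channel splits uniquely into a black channel and a white channel. -/
def channelEquivProd {V : Type*} [Finite V] (G : SimpleGraph V)
    (color : V → Bool) (hcol : ∀ ⦃v w : V⦄, G.Adj v w → color v ≠ color w) :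
    {C : Set V // IsChannel G C} ≃
      {C : Set V // IsChannel G C ∧ ∀ v ∈ C, color v = true} ×
        {C : Set V // IsChannel G C ∧ ∀ v ∈ C, color v = false} where
  toFun C := (⟨C.1 ∩ {v | color v = true}, C.2.inter_color hcol true, fun _ hv => hv.2⟩,
    ⟨C.1 ∩ {v | color v = false}, C.2.inter_color hcol false, fun _ hv => hv.2⟩)
  invFun P := ⟨P.1.1 ∪ P.2.1, P.1.2.1.union P.2.2.1 <| Set.disjoint_left.2 fun v h₁ h₂ => by
    simpa [P.1.2.2 v h₁] using P.2.2.2 v h₂⟩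
  left_inv C := by
    ext v
    cases h : color v <;> simp [h]
  right_inv P := by
    obtain ⟨⟨C, hC, hCt⟩, ⟨D, hD, hDf⟩⟩ := P
    ext v
    · have := hCt v
      have := hDf v
      simp only [Set.mem_inter_iff, Set.mem_union, Set.mem_ofPred_eq]
      grind
    · have := hCt v
      have := hDf v
      simp only [Set.mem_inter_iff, Set.mem_union, Set.mem_ofPred_eq]
      grind

/-- `2^{|V_W|} · |C_B(G)| = 2^{|V_B|} · |C_W(G)|`; in particular if `|V_B| = |V_W|` then
`|C_B(G)| = |C_W(G)|` and the number of channels equals `|C_B(G)|²`. -/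
theorem dim_black_channels_sub_white {V : Type*} [Fintype V] (G : SimpleGraph V)
    (color : V → Bool) (hcol : ∀ ⦃v w : V⦄, G.Adj v w → color v ≠ color w) :
    2 ^ (Fintype.card {v : V // color v = false}) *
        Nat.card {C : Set V // IsChannel G C ∧ ∀ v ∈ C, color v = true} =
      2 ^ (Fintype.card {v : V // color v = true}) *
        Nat.card {C : Set V // IsChannel G C ∧ ∀ v ∈ C, color v = false} ∧
    (Fintype.card {v : V // color v = true} = Fintype.card {v : V // color v = false} →
      Nat.card {C : Set V // IsChannel G C ∧ ∀ v ∈ C, color v = true} =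
          Nat.card {C : Set V // IsChannel G C ∧ ∀ v ∈ C, color v = false} ∧
        Nat.card {C : Set V // IsChannel G C} =
          (Nat.card {C : Set V // IsChannel G C ∧ ∀ v ∈ C, color v = true}) ^ 2) := by
  have h₁ := card_channels_mul_two_pow_rank G color hcol Bool.false_ne_true
  have h₂ := card_channels_mul_two_pow_rank G color hcol Bool.false_ne_true.symm
  rw [← biadjMatrix_transpose, Matrix.rank_transpose] at h₂
  refine ⟨?_, fun h => ?_⟩
  · rw [← h₁, ← h₂]
    ring
  · have hcard := Nat.eq_of_mul_eq_mul_left (by positivity) (h₁.trans (h ▸ h₂.symm))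
    refine ⟨hcard, ?_⟩
    rw [Nat.card_congr (channelEquivProd G color hcol), Nat.card_prod, ← hcard, sq]
end

section
/- For all natural numbers m, n ≥ 0, the grid graph R_{m×n} has an odd number of perfect matchings if and only if gcd(m+1, n+1) = 1. -/
/-- The number of perfect matchings of a graph `G`. -/
noncomputable def matchCount {V : Type*} (G : SimpleGraph V) : ℕ :=
  Nat.card {M : G.Subgraph // M.IsPerfectMatching}

/-- The grid graph `R_{m×n}` on `{0,…,m−1} × {0,…,n−1}`: two vertices are adjacent iff
they differ by exactly 1 in exactly one coordinate. -/
def gridGraph (m n : ℕ) : SimpleGraph (Fin m × Fin n) :=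
  SimpleGraph.fromRel (fun v w =>
    (v.1 = w.1 ∧ (v.2 : ℕ) + 1 = (w.2 : ℕ)) ∨ (v.2 = w.2 ∧ (v.1 : ℕ) + 1 = (w.1 : ℕ)))

/-- Over `ZMod 2`, the determinant of the adjacency matrix counts the permutations that map every
vertex to a neighbour. -/
lemma det_adjMatrix_zmod_two_eq_sum {V : Type*} [Fintype V] [DecidableEq V] (G : SimpleGraph V)
    [DecidableRel G.Adj] :
    (G.adjMatrix (ZMod 2)).det =
      ∑ σ : Equiv.Perm V, if ∀ v, G.Adj v (σ v) then (1 : ZMod 2) else 0 := by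
  rw [Matrix.det_apply]
  refine Finset.sum_congr rfl fun σ _ => ?_
  have hsign : ∀ x : ZMod 2, Equiv.Perm.sign σ • x = x := by
    intro x
    rcases Int.units_eq_one_or (Equiv.Perm.sign σ) with h | h <;> rw [h]
    · simp
    · simp [Units.smul_def, CharTwo.neg_eq]
  rw [hsign]
  simp only [SimpleGraph.adjMatrix_apply, G.adj_comm (σ _)]
  rw [Finset.prod_ite_zero]
  simp

/-- The graph of a fixed-point-free involution along edges, as a subgraph. -/
def involutionSubgraph {V : Type*} (G : SimpleGraph V) (σ : Equiv.Perm V) (hσ : σ⁻¹ = σ)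
    (hG : ∀ v, G.Adj v (σ v)) : G.Subgraph where
  verts := Set.univ
  Adj v w := σ v = w
  adj_sub := by
    rintro v _ rfl
    exact hG v
  edge_vert _ := Set.mem_univ _
  symm := ⟨by
    rintro v _ rfl
    nth_rewrite 1 [← hσ]
    simp⟩

/-- Perfect matchings are counted by the involutions that map every vertex to a neighbour. -/
lemma card_involutions_eq_matchCount {V : Type*} (G : SimpleGraph V) :
    Nat.card {σ : Equiv.Perm V // σ⁻¹ = σ ∧ ∀ v, G.Adj v (σ v)} = matchCount G := by
  refine Nat.card_congr (Equiv.ofBijective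
    (fun σ => ⟨involutionSubgraph G σ.1 σ.2.1 σ.2.2, ?_⟩) ⟨?_, ?_⟩)
  · rw [SimpleGraph.Subgraph.isPerfectMatching_iff]
    exact fun v => ⟨σ.1 v, rfl, fun w hw => Eq.symm hw⟩
  · rintro ⟨σ, hσ⟩ ⟨τ, hτ⟩ h
    have hAdj := congrArg SimpleGraph.Subgraph.Adj (Subtype.mk.inj h)
    ext v
    have hv : (τ v = σ v) = (τ v = τ v) := by
      have := congrFun (congrFun hAdj v) (τ v)
      simpa [involutionSubgraph, eq_comm] using this
    exact (hv.mpr rfl).symm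
  · rintro ⟨M, hM⟩
    choose f hf hunique using SimpleGraph.Subgraph.isPerfectMatching_iff.mp hM
    have hinv : Function.Involutive f := fun v => (hunique (f v) v (hf v).symm).symm
    refine ⟨⟨hinv.toPerm f, hinv.toPerm_symm, fun v => M.adj_sub (hf v)⟩, ?_⟩
    apply Subtype.ext
    ext v w
    · simp [involutionSubgraph, hM.2 v]
    · constructor
      · rintro rfl
        exact hf v
      · exact fun h => (hunique v w h).symm

/-- The number of perfect matchings has the parity of the determinant of the adjacency matrix. -/
lemma det_adjMatrix_zmod_two {V : Type*} [Fintype V] [DecidableEq V] (G : SimpleGraph V)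
    [DecidableRel G.Adj] :
    (G.adjMatrix (ZMod 2)).det = matchCount G := by
  have hinv : ∀ σ : Equiv.Perm V, (∀ v, G.Adj v (σ⁻¹ v)) ↔ ∀ v, G.Adj v (σ v) := by
    intro σ
    constructor
    · intro h v
      simpa using (h (σ v)).symm
    · intro h v
      simpa using (h (σ⁻¹ v)).symm
  rw [det_adjMatrix_zmod_two_eq_sum,
    ← Finset.sum_filter_add_sum_filter_not _ (fun σ : Equiv.Perm V => σ⁻¹ = σ)]
  have hzero : (∑ σ : Equiv.Perm V with ¬ σ⁻¹ = σ,
      if ∀ v, G.Adj v (σ v) then (1 : ZMod 2) else 0) = 0 := by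
    refine Finset.sum_involution (fun σ _ => σ⁻¹) ?_ ?_ ?_ ?_
    · intro σ _
      simp only [hinv, CharTwo.add_self_eq_zero]
    · intro σ hσ _
      simpa using hσ
    · intro σ hσ
      simpa [eq_comm] using hσ
    · simp
  rw [hzero, add_zero, ← card_involutions_eq_matchCount, Finset.sum_boole, Finset.filter_filter,
    Nat.card_eq_fintype_card, Fintype.card_subtype]

/-- The matching count is odd iff the adjacency matrix has trivial kernel over `ZMod 2`. -/
lemma odd_matchCount_iff {V : Type*} [Fintype V] [DecidableEq V] (G : SimpleGraph V)
    [DecidableRel G.Adj] :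
    Odd (matchCount G) ↔
      ∀ f : V → ZMod 2, (G.adjMatrix (ZMod 2)).mulVec f = 0 → f = 0 := by
  rw [← ZMod.natCast_eq_one_iff_odd, ← det_adjMatrix_zmod_two]
  have hone : ∀ x : ZMod 2, x = 1 ↔ ¬ x = 0 := by decide
  rw [hone, ← Matrix.exists_mulVec_eq_zero_iff]
  push Not
  exact ⟨fun h f hf => by_contra fun hne => h f hne hf, fun h f hne hf => hne (h f hf)⟩

/-- Extension of a function on the grid by zero, in coordinates starting at `1`. -/
def gridExtend {m n : ℕ} (f : Fin m × Fin n → ZMod 2) (x y : ℕ) : ZMod 2 :=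
  if h : (1 ≤ x ∧ x ≤ m) ∧ (1 ≤ y ∧ y ≤ n) then f (⟨x - 1, by omega⟩, ⟨y - 1, by omega⟩) else 0

lemma gridGraph_adj {m n : ℕ} (v w : Fin m × Fin n) :
    (gridGraph m n).Adj v w ↔
      (v.1 = w.1 ∧ ((v.2 : ℕ) + 1 = w.2 ∨ (w.2 : ℕ) + 1 = v.2)) ∨
      (v.2 = w.2 ∧ ((v.1 : ℕ) + 1 = w.1 ∨ (w.1 : ℕ) + 1 = v.1)) := by
  obtain ⟨a, b⟩ := v
  obtain ⟨c, d⟩ := w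
  simp only [gridGraph, SimpleGraph.fromRel_adj, ne_eq, Prod.mk.injEq, Fin.ext_iff]
  omega

lemma sum_ite_eq_gridExtend {m n : ℕ} (f : Fin m × Fin n → ZMod 2) (x y : ℕ) :
    (∑ w : Fin m × Fin n, if (w.1 : ℕ) + 1 = x ∧ (w.2 : ℕ) + 1 = y then f w else 0) =
      gridExtend f x y := by
  unfold gridExtend
  split_ifs with h
  · rw [Finset.sum_eq_single (⟨x - 1, by omega⟩, ⟨y - 1, by omega⟩)]
    · rw [if_pos]
      simp only
      omega
    · rintro ⟨a, b⟩ _ hne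
      rw [if_neg]
      simp only [ne_eq, Prod.mk.injEq, Fin.ext_iff] at hne
      simp only
      omega
    · simp
  · refine Finset.sum_eq_zero fun w _ => if_neg ?_
    have := w.1.2
    have := w.2.2
    omega

/-- The adjacency matrix of the grid sums the four neighbours. -/
lemma gridGraph_mulVec {m n : ℕ} [DecidableRel (gridGraph m n).Adj]
    (f : Fin m × Fin n → ZMod 2) (v : Fin m × Fin n) :
    ((gridGraph m n).adjMatrix (ZMod 2)).mulVec f v =
      gridExtend f (v.1 + 1) (v.2 + 2) + gridExtend f (v.1 + 1) v.2 +
        gridExtend f (v.1 + 2) (v.2 + 1) + gridExtend f v.1 (v.2 + 1) := by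
  simp only [← sum_ite_eq_gridExtend, ← Finset.sum_add_distrib, Matrix.mulVec, dotProduct,
    SimpleGraph.adjMatrix_apply]
  refine Finset.sum_congr rfl fun w _ => ?_
  simp only [gridGraph_adj, Fin.ext_iff, ite_mul, one_mul, zero_mul]
  by_cases h1 : (w.1 : ℕ) + 1 = v.1 + 1 ∧ (w.2 : ℕ) + 1 = v.2 + 2
  · rw [if_pos (by omega), if_pos h1, if_neg (by omega), if_neg (by omega), if_neg (by omega)]
    simp
  by_cases h2 : (w.1 : ℕ) + 1 = v.1 + 1 ∧ (w.2 : ℕ) + 1 = v.2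
  · rw [if_pos (by omega), if_neg h1, if_pos h2, if_neg (by omega), if_neg (by omega)]
    simp
  by_cases h3 : (w.1 : ℕ) + 1 = v.1 + 2 ∧ (w.2 : ℕ) + 1 = v.2 + 1
  · rw [if_pos (by omega), if_neg h1, if_neg h2, if_pos h3, if_neg (by omega)]
    simp
  by_cases h4 : (w.1 : ℕ) + 1 = v.1 ∧ (w.2 : ℕ) + 1 = v.2 + 1
  · rw [if_pos (by omega), if_neg h1, if_neg h2, if_neg h3, if_pos h4]
    simp
  · rw [if_neg (by omega), if_neg h1, if_neg h2, if_neg h3, if_neg h4]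
    simp

/-- The indicator of the two families of diagonals modulo `2 * d`. -/
def diagonalPattern (d : ℕ) (x y : ℕ) : ZMod 2 :=
  (if ((x : ℤ) - y : ZMod (2 * d)) = 0 then 1 else 0) +
    (if ((x : ℤ) + y : ZMod (2 * d)) = 0 then 1 else 0)

lemma diagonalPattern_eq_zero_left {d x : ℕ} (hx : d ∣ x) (y : ℕ) :
    diagonalPattern d x y = 0 := by
  obtain ⟨k, rfl⟩ := hx
  have h : (2 * d : ZMod (2 * d)) = 0 := by exact_mod_cast ZMod.natCast_self (2 * d)
  have key : ((((d * k : ℕ) : ℤ) : ZMod (2 * d)) - y = 0) ↔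
      ((((d * k : ℕ) : ℤ) : ZMod (2 * d)) + y = 0) := by
    push_cast
    constructor <;> intro h'
    · linear_combination k * h - h'
    · linear_combination k * h - h'
  simp only [diagonalPattern, key, CharTwo.add_self_eq_zero]

lemma diagonalPattern_comm (d x y : ℕ) : diagonalPattern d x y = diagonalPattern d y x := by
  unfold diagonalPattern
  congr 2
  · rw [sub_eq_zero, sub_eq_zero]
    push_cast
    simp [eq_comm]
  · push_cast
    rw [add_comm]

lemma diagonalPattern_neighbours (d x y : ℕ) :
    diagonalPattern d (x + 1) (y + 2) + diagonalPattern d (x + 1) y +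
      diagonalPattern d (x + 2) (y + 1) + diagonalPattern d x (y + 1) = 0 := by
  have e1 : (x : ZMod (2 * d)) + 1 - (y + 2) = x - (y + 1) := by ring
  have e2 : (x : ZMod (2 * d)) + 1 - y = x + 2 - (y + 1) := by ring
  have e3 : (x : ZMod (2 * d)) + 1 + (y + 2) = x + 2 + (y + 1) := by ring
  have e4 : (x : ZMod (2 * d)) + 1 + y = x + (y + 1) := by ring
  have h2 : (2 : ZMod 2) = 0 := rfl
  simp only [diagonalPattern]
  push_cast
  rw [e1, e2, e3, e4]
  ring_nf
  simp [h2]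

lemma gridExtend_diagonalPattern {m n d : ℕ} (hm : d ∣ m + 1) (hn : d ∣ n + 1) {x y : ℕ}
    (hx : x ≤ m + 1) (hy : y ≤ n + 1) :
    gridExtend (fun v : Fin m × Fin n => diagonalPattern d (v.1 + 1) (v.2 + 1)) x y =
      diagonalPattern d x y := by
  unfold gridExtend
  split_ifs with h
  · simp only
    congr 1 <;> omega
  · have hcases : x = 0 ∨ x = m + 1 ∨ y = 0 ∨ y = n + 1 := by omega
    rcases hcases with rfl | rfl | rfl | rfl
    · exact (diagonalPattern_eq_zero_left (dvd_zero d) y).symm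
    · exact (diagonalPattern_eq_zero_left hm y).symm
    · rw [diagonalPattern_comm, diagonalPattern_eq_zero_left (dvd_zero d)]
    · rw [diagonalPattern_comm, diagonalPattern_eq_zero_left hn]

/-- A common divisor of `m + 1` and `n + 1` other than `1` yields a nonzero kernel vector. -/
lemma exists_kernel_of_dvd {m n d : ℕ} [DecidableRel (gridGraph m n).Adj] (hd : d ≠ 1)
    (hm : d ∣ m + 1) (hn : d ∣ n + 1) :
    ∃ f : Fin m × Fin n → ZMod 2,
      ((gridGraph m n).adjMatrix (ZMod 2)).mulVec f = 0 ∧ f ≠ 0 := by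
  have hd0 : d ≠ 0 := by
    rintro rfl
    simp at hm
  have hdm := Nat.le_of_dvd (by omega) hm
  have hdn := Nat.le_of_dvd (by omega) hn
  refine ⟨fun v => diagonalPattern d (v.1 + 1) (v.2 + 1), ?_, ?_⟩
  · ext v
    have := v.1.2
    have := v.2.2
    rw [gridGraph_mulVec, gridExtend_diagonalPattern hm hn (by omega) (by omega),
      gridExtend_diagonalPattern hm hn (by omega) (by omega),
      gridExtend_diagonalPattern hm hn (by omega) (by omega),
      gridExtend_diagonalPattern hm hn (by omega) (by omega)]
    exact diagonalPattern_neighbours d v.1 v.2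
  · intro h
    have h0 := congrFun h (⟨0, by omega⟩, ⟨0, by omega⟩)
    have hne : ¬ ((1 : ZMod (2 * d)) + 1 = 0) := by
      intro h2
      have : ((2 : ℕ) : ZMod (2 * d)) = 0 := by
        push_cast
        linear_combination h2
      rw [ZMod.natCast_eq_zero_iff] at this
      have := Nat.le_of_dvd (by omega) this
      omega
    simp [diagonalPattern, hne] at h0

/-- The solution of the discrete wave equation over `ZMod 2` with initial rows `0` and `g`. -/
def wave (g : ℤ → ZMod 2) : ℕ → ℤ → ZMod 2
  | 0, _ => 0
  | 1, y => g y
  | x + 2, y => wave g (x + 1) (y - 1) + wave g (x + 1) (y + 1) + wave g x y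

lemma wave_add_right (g : ℤ → ZMod 2) (x : ℕ) (y : ℤ) :
    wave g (x + 1) y + wave g x (y + 1) = g (y - x) := by
  induction x generalizing y with
  | zero => simp [wave]
  | succ x ih =>
    have h2 : (2 : ZMod 2) = 0 := rfl
    have h := ih (y - 1)
    rw [show y - 1 + 1 = y by ring, show y - 1 - (x : ℤ) = y - ((x + 1 : ℕ) : ℤ) by
      push_cast; ring] at h
    rw [wave]
    linear_combination h + wave g (x + 1) (y + 1) * h2

lemma wave_add_left (g : ℤ → ZMod 2) (x : ℕ) (y : ℤ) :
    wave g (x + 1) y + wave g x (y - 1) = g (y + x) := by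
  induction x generalizing y with
  | zero => simp [wave]
  | succ x ih =>
    have h2 : (2 : ZMod 2) = 0 := rfl
    have h := ih (y + 1)
    rw [show y + 1 - 1 = y by ring, show y + 1 + (x : ℤ) = y + ((x + 1 : ℕ) : ℤ) by
      push_cast; ring] at h
    rw [wave]
    linear_combination h + wave g (x + 1) (y - 1) * h2

/-- A wave that is reflected about `c / 2` stays so. -/
lemma wave_reflect {g : ℤ → ZMod 2} {c : ℤ} (hg : ∀ y, g (c - y) = g y) (x : ℕ) (y : ℤ) :
    wave g x (c - y) = wave g x y := by
  induction x using Nat.twoStepInduction generalizing y with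
  | zero => rfl
  | one => exact hg y
  | more x ih ih' =>
    rw [wave, wave, ih, show c - y - 1 = c - (y + 1) by ring, show c - y + 1 = c - (y - 1) by ring,
      ih', ih']
    ring

/-- A wave vanishes on a mirror on which the initial row vanishes. -/
lemma wave_mirror {g : ℤ → ZMod 2} {c : ℤ} (hg : ∀ y, g (2 * c - y) = g y) (hc : g c = 0)
    (x : ℕ) : wave g x c = 0 := by
  induction x using Nat.twoStepInduction with
  | zero => rfl
  | one => exact hc
  | more x ih ih' =>
    have h := wave_reflect hg (x + 1) (c + 1)
    rw [show 2 * c - (c + 1) = c - 1 by ring] at h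
    rw [wave, ih, h, CharTwo.add_self_eq_zero, add_zero]

lemma wave_periodic_of_row_zero {g : ℤ → ZMod 2} {M : ℕ} (h : ∀ y, wave g M y = 0) :
    Function.Periodic g (2 * M) := by
  intro y
  have h1 := wave_add_right g M (y + M)
  have h2 := wave_add_left g M (y + M)
  rw [h] at h1 h2
  rw [show y + (M : ℤ) - M = y by ring] at h1
  rw [show y + (M : ℤ) + M = y + 2 * M by ring] at h2
  rw [← h1, ← h2]

lemma wave_of_periodic_two {g : ℤ → ZMod 2} (hg : Function.Periodic g 2) (x : ℕ) (y : ℤ) :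
    wave g x y = x * g (y + x + 1) := by
  induction x using Nat.twoStepInduction generalizing y with
  | zero => simp [wave]
  | one =>
    have := hg y
    rw [wave]
    push_cast
    rw [show y + 1 + 1 = y + 2 by ring, this, one_mul]
  | more x ih ih' =>
    have h2 : (2 : ZMod 2) = 0 := rfl
    have h := hg (y + x + 1)
    rw [wave, ih, ih', ih']
    push_cast
    rw [show y - 1 + (x + 1) + 1 = y + (x : ℤ) + 1 by ring,
      show y + 1 + (x + 1) + 1 = y + (x : ℤ) + 1 + 2 by ring,
      show y + (x + 2) + 1 = y + (x : ℤ) + 1 + 2 by ring, h]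
    linear_combination x * g (y + x + 1) * h2

/-- A `2 * N`-periodic row vanishing at `0` and `N`, whose wave vanishes at time `M` coprime to `N`,
is zero. -/
lemma eq_zero_of_wave_eq_zero {g : ℤ → ZMod 2} {M N : ℕ} (hMN : Nat.Coprime M N)
    (hN : Function.Periodic g (2 * N)) (h0 : g 0 = 0) (hgN : g N = 0)
    (hM : ∀ y, wave g M y = 0) : g = 0 := by
  have hper : Function.Periodic g 2 := by
    have h1 := (wave_periodic_of_row_zero hM).int_mul (Nat.gcdA M N)
    have h2 := hN.int_mul (Nat.gcdB M N)
    have hb := Nat.gcd_eq_gcd_ab M N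
    rw [hMN.gcd_eq_one] at hb
    have hsum : (Nat.gcdA M N : ℤ) * (2 * M) + Nat.gcdB M N * (2 * N) = 2 := by
      push_cast at hb
      linear_combination -2 * hb
    have h3 := h1.add_period h2
    rwa [Int.cast_id, Int.cast_id, hsum] at h3
  have heven : ∀ k : ℤ, g (k * 2) = 0 := by
    intro k
    have := hper.int_mul k 0
    simpa [h0] using this
  have hodd : ∀ k : ℤ, g (k * 2 + 1) = g 1 := by
    intro k
    have := hper.int_mul k 1
    simpa [add_comm] using this
  have hg1 : g 1 = 0 := by
    rcases Nat.even_or_odd N with hE | ⟨k, hk⟩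
    · have hMo : Odd M := by
        by_contra hMe
        rw [Nat.not_odd_iff_even] at hMe
        have := Nat.dvd_gcd hMe.two_dvd hE.two_dvd
        rw [hMN.gcd_eq_one] at this
        omega
      have h := hM (-M)
      rw [wave_of_periodic_two hper, ZMod.natCast_eq_one_iff_odd.mpr hMo] at h
      simpa using h
    · rw [← hodd k, ← hgN, hk]
      congr 1
      push_cast
      ring
  funext y
  rcases Int.even_or_odd' y with ⟨k, rfl | rfl⟩
  · rw [mul_comm]
    exact heven k
  · rw [mul_comm, hodd, hg1]
    rfl

/-- Even, `2 * N`-periodic extension of a function on `{0, …, N}`. -/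
def reflectExtend (N : ℕ) (h : ℕ → ZMod 2) (y : ℤ) : ZMod 2 :=
  if y % (2 * N) ≤ N then h (y % (2 * N)).toNat else h (2 * N - y % (2 * N)).toNat

lemma reflectExtend_periodic (N : ℕ) (h : ℕ → ZMod 2) :
    Function.Periodic (reflectExtend N h) (2 * N) := by
  intro y
  simp [reflectExtend]

lemma reflectExtend_natCast {N : ℕ} (hN : 0 < N) (h : ℕ → ZMod 2) {y : ℕ} (hy : y ≤ N) :
    reflectExtend N h y = h y := by
  have hmod : (y : ℤ) % (2 * N) = y := Int.emod_eq_of_lt (by omega) (by omega)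
  simp [reflectExtend, hmod, hy]

lemma reflectExtend_neg {N : ℕ} (hN : 0 < N) (h : ℕ → ZMod 2) (y : ℤ) :
    reflectExtend N h (-y) = reflectExtend N h y := by
  have hlt := Int.emod_lt_of_pos y (show (0 : ℤ) < 2 * N by omega)
  have hnn := Int.emod_nonneg y (show (2 * N : ℤ) ≠ 0 by omega)
  unfold reflectExtend
  by_cases hr : y % (2 * N) = 0
  · have hneg : -y % (2 * N) = 0 :=
      Int.emod_eq_zero_of_dvd ((Int.dvd_of_emod_eq_zero hr).neg_right)
    rw [hr, hneg]
  · have hneg : -y % (2 * N) = 2 * N - y % (2 * N) := by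
      rw [← Int.emod_eq_of_lt (a := 2 * N - y % (2 * N)) (b := 2 * N) (by omega) (by omega)]
      apply Int.emod_eq_emod_iff_emod_sub_eq_zero.mpr
      apply Int.emod_eq_zero_of_dvd
      refine ⟨-(y / (2 * N)) - 1, ?_⟩
      linear_combination Int.emod_add_mul_ediv y (2 * N)
    rw [hneg]
    rcases lt_trichotomy (y % (2 * N)) N with hc | hc | hc
    · rw [if_neg (by omega), if_pos (by omega)]
      congr 2
      ring
    · rw [if_pos (by omega), if_pos (by omega)]
      congr 2
      omega
    · rw [if_pos (by omega), if_neg (by omega)]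

/-- An even `2 * N`-periodic function is determined by its values on `{0, …, N}`. -/
lemma eq_zero_of_even_periodic {N : ℕ} (hN : 0 < N) {φ : ℤ → ZMod 2} (heven : ∀ y, φ (-y) = φ y)
    (hper : Function.Periodic φ (2 * N)) (hφ : ∀ y : ℕ, y ≤ N → φ y = 0) (y : ℤ) : φ y = 0 := by
  have hlt := Int.emod_lt_of_pos y (show (0 : ℤ) < 2 * N by omega)
  have hnn := Int.emod_nonneg y (show (2 * N : ℤ) ≠ 0 by omega)
  have hmod : φ y = φ (y % (2 * N)) := by
    rw [← hper.int_mul (y / (2 * N)) (y % (2 * N))]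
    congr 1
    linear_combination -Int.emod_add_mul_ediv y (2 * N)
  rw [hmod]
  by_cases hr : y % (2 * N) ≤ N
  · rw [← Int.toNat_of_nonneg hnn]
    exact hφ _ (by omega)
  · rw [← heven, ← hper, ← Int.toNat_of_nonneg (show 0 ≤ -(y % (2 * N)) + 2 * N by omega)]
    exact hφ _ (by omega)

/-- If `m + 1` and `n + 1` are coprime, the adjacency matrix of the grid has trivial kernel. -/
lemma kernel_trivial_of_coprime {m n : ℕ} [DecidableRel (gridGraph m n).Adj]
    (hmn : Nat.Coprime (m + 1) (n + 1)) (f : Fin m × Fin n → ZMod 2)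
    (hf : ((gridGraph m n).adjMatrix (ZMod 2)).mulVec f = 0) : f = 0 := by
  have hrec : ∀ x y, x < m → y < n →
      gridExtend f (x + 2) (y + 1) =
        gridExtend f (x + 1) y + gridExtend f (x + 1) (y + 2) + gridExtend f x (y + 1) := by
    intro x y hx hy
    have h2 : (2 : ZMod 2) = 0 := rfl
    have h := congrFun hf (⟨x, hx⟩, ⟨y, hy⟩)
    rw [gridGraph_mulVec] at h
    simp only [Pi.zero_apply] at h
    linear_combination h - (gridExtend f (x + 1) y + gridExtend f (x + 1) (y + 2) +
      gridExtend f x (y + 1)) * h2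
  have hbot : ∀ x, gridExtend f x 0 = 0 := fun x => dif_neg (by omega)
  have htop : ∀ x, gridExtend f x (n + 1) = 0 := fun x => dif_neg (by omega)
  set g := reflectExtend (n + 1) (gridExtend f 1)
  have hgval : ∀ y : ℕ, y ≤ n + 1 → g y = gridExtend f 1 y := fun y hy =>
    reflectExtend_natCast (Nat.succ_pos n) _ hy
  have hper : Function.Periodic g (2 * (n + 1 : ℕ)) := reflectExtend_periodic _ _
  have hneg : ∀ y, g (-y) = g y := reflectExtend_neg (Nat.succ_pos n) _
  have hg0 : g 0 = 0 := by
    have := hgval 0 (by omega)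
    rwa [hbot] at this
  have hgN : g (n + 1 : ℕ) = 0 := by
    rw [hgval _ le_rfl, htop]
  have hrefl : ∀ y, g (2 * (n + 1 : ℕ) - y) = g y := fun y => by
    rw [← hneg y, ← hper (-y)]
    congr 1
    ring
  have hw0 : ∀ x, wave g x 0 = 0 := wave_mirror (fun y => by simpa using hneg y) hg0
  have hwN : ∀ x, wave g x (n + 1 : ℕ) = 0 := wave_mirror hrefl hgN
  have hwave : ∀ x, x ≤ m + 1 → ∀ y : ℕ, y ≤ n + 1 → wave g x y = gridExtend f x y := by
    intro x
    induction x using Nat.twoStepInduction with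
    | zero =>
      intro _ y _
      exact (show gridExtend f 0 y = 0 from dif_neg (by omega)).symm
    | one =>
      intro _ y hy
      exact hgval y hy
    | more x ih ih' =>
      intro hx y hy
      rcases Nat.eq_zero_or_pos y with rfl | hpos
      · rw [hbot]
        exact hw0 _
      rcases Nat.eq_or_lt_of_le hy with rfl | hlt
      · rw [htop, hwN]
      obtain ⟨z, rfl⟩ : ∃ z, y = z + 1 := ⟨y - 1, by omega⟩
      rw [hrec x z (by omega) (by omega), ← ih (by omega) _ hy, ← ih' (by omega) z (by omega),
        ← ih' (by omega) (z + 2) (by omega), wave]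
      congr 3
      push_cast
      ring
  have hM : ∀ y, wave g (m + 1) y = 0 := by
    have hnat : ∀ y : ℕ, y ≤ n + 1 → wave g (m + 1) y = 0 := fun y hy => by
      rw [hwave _ le_rfl y hy]
      exact dif_neg (by omega)
    refine eq_zero_of_even_periodic (Nat.succ_pos n) (fun y => ?_) (fun y => ?_) hnat
    · simpa using wave_reflect (c := 0) (fun y => by simpa using hneg y) (m + 1) y
    · have hw := wave_reflect (c := 2 * (n + 1 : ℕ)) hrefl (m + 1) (-y)
      rw [show y + 2 * ((n + 1 : ℕ) : ℤ) = 2 * ((n + 1 : ℕ) : ℤ) - -y by ring, hw]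
      simpa using wave_reflect (c := 0) (fun y => by simpa using hneg y) (m + 1) y
  have hgz : g = 0 := eq_zero_of_wave_eq_zero hmn hper hg0 hgN hM
  have hwz : ∀ x y, wave g x y = 0 := by
    intro x y
    rw [hgz, wave_of_periodic_two (fun _ => rfl)]
    simp
  funext v
  have h := hwave (v.1 + 1) (by omega) (v.2 + 1) (by omega)
  rw [hwz, gridExtend, dif_pos (by omega)] at h
  exact h.symm

/-- `R_{m×n}` has an odd number of perfect matchings iff `gcd(m+1, n+1) = 1`. -/
theorem grid_odd_matchCount_iff (m n : ℕ) :
    Odd (matchCount (gridGraph m n)) ↔ Nat.gcd (m + 1) (n + 1) = 1 := by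
  classical
  rw [odd_matchCount_iff]
  constructor
  · intro h
    by_contra hd
    obtain ⟨f, hf, hne⟩ := exists_kernel_of_dvd hd (Nat.gcd_dvd_left (m + 1) (n + 1))
      (Nat.gcd_dvd_right (m + 1) (n + 1))
    exact hne (h f hf)
  · exact fun h f hf => kernel_trivial_of_coprime h f hf
end
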